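/- Let M be an L-structure, A ⊆ M, and suppose M is strongly homogeneous over A. Let p and q be complete types over A. Then p(M) and q(M) are commensurable over A if and only if there exists a complete correspondence over A between p and q and all complete correspondences over A between p and q have the same ratio; in that case this common ratio equals m_p^q. -/

import Mathlib

open FirstOrder Set

namespace Unimod

universe u v w

variable (L : FirstOrder.Language.{u, v}) {M : Type w} [L.Structure M]

/-- Two tuples (indexed by `α`) satisfy the same `L`-formulas with parameters from `A`,
i.e. they have the same complete type over `A`. -/
def SameType (A : Set M) {α : Type*} (a b : α → M) : Prop :=
  ∀ φ : L.Formula (↥A ⊕ α),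
    φ.Realize (Sum.elim (fun x => (x : M)) a) ↔ φ.Realize (Sum.elim (fun x => (x : M)) b)

/-- The set of realizations of the complete type of the tuple `a` over `A`. -/
def typeSet (A : Set M) {α : Type*} (a : α → M) : Set (α → M) :=
  {b | SameType L A a b}

/-- A set is type-definable over `A` if it is an intersection of a family of `A`-definable
sets. -/
def TypeDefinable (A : Set M) {α : Type*} (s : Set (α → M)) : Prop :=
  ∃ S : Set (Set (α → M)), (∀ t ∈ S, A.Definable L t) ∧ s = ⋂₀ S

/-- View a set of pairs of tuples as a set of `Fin n ⊕ Fin m`-indexed tuples. -/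
def pairSet {M : Type w} {n m : ℕ} (C : Set ((Fin n → M) × (Fin m → M))) :
    Set ((Fin n ⊕ Fin m) → M) :=
  {v | (v ∘ Sum.inl, v ∘ Sum.inr) ∈ C}

/-- A correspondence over `A` between `X ⊆ M^n` and `Y ⊆ M^m`: a nonempty subset of `X × Y`,
type-definable over `A`, all of whose fibres and cofibres are finite. -/
structure IsCorrespondence (A : Set M) {n m : ℕ} (X : Set (Fin n → M)) (Y : Set (Fin m → M))
    (C : Set ((Fin n → M) × (Fin m → M))) : Prop where
  nonempty : C.Nonempty
  subset : C ⊆ X ×ˢ Y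
  typeDefinable : TypeDefinable L A (pairSet C)
  finite_fibers : ∀ x ∈ X, {y | (x, y) ∈ C}.Finite
  finite_cofibers : ∀ y ∈ Y, {x | (x, y) ∈ C}.Finite

/-- A uniform correspondence over `A` with constant fibre size `k` and cofibre size `ℓ`. -/
structure IsUniformCorrespondence (A : Set M) {n m : ℕ} (X : Set (Fin n → M))
    (Y : Set (Fin m → M)) (C : Set ((Fin n → M) × (Fin m → M))) (k ℓ : ℕ)
    extends IsCorrespondence L A X Y C : Prop where
  k_pos : 0 < k
  l_pos : 0 < ℓ
  fiber_card : ∀ x ∈ X, {y | (x, y) ∈ C}.ncard = k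
  cofiber_card : ∀ y ∈ Y, {x | (x, y) ∈ C}.ncard = ℓ

/-- A type-definable set `X` is measurable over `A` if every uniform correspondence over `A`
between `X` and itself is balanced. -/
def MeasurableOver (A : Set M) {n : ℕ} (X : Set (Fin n → M)) : Prop :=
  ∀ (C : Set ((Fin n → M) × (Fin n → M))) (k ℓ : ℕ),
    IsUniformCorrespondence L A X X C k ℓ → k = ℓ

/-- `X` and `Y` are commensurable over `A`, with common ratio `r`. -/
def CommensurableOverWithRatio (A : Set M) {n m : ℕ} (X : Set (Fin n → M))
    (Y : Set (Fin m → M)) (r : ℚ) : Prop :=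
  (∃ C k ℓ, IsUniformCorrespondence L A X Y C k ℓ) ∧
    ∀ C k ℓ, IsUniformCorrespondence L A X Y C k ℓ → (k : ℚ) / (ℓ : ℚ) = r

/-- `X` and `Y` are commensurable over `A`: there is a uniform correspondence over `A` between
them, and all such have the same ratio. -/
def CommensurableOver (A : Set M) {n m : ℕ} (X : Set (Fin n → M)) (Y : Set (Fin m → M)) : Prop :=
  ∃ r : ℚ, CommensurableOverWithRatio L A X Y r

/-- `M` is strongly homogeneous over `A`: any two tuples with the same type over `A` are
conjugate by an automorphism of `M` fixing `A` pointwise. -/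
def StronglyHomogeneousOver (A : Set M) : Prop :=
  ∀ (n : ℕ) (a b : Fin n → M), SameType L A a b →
    ∃ σ : M ≃[L] M, (∀ x ∈ A, σ x = x) ∧ ∀ i, σ (a i) = b i

/-- `M` is unimodular (with respect to the cardinal bound `κ` on parameter sets):
whenever `a ≡_A b` are interalgebraic over `A`, then `m(a/A ∪ b) = m(b/A ∪ a)`. -/
def Unimodular (κ : Cardinal.{w}) : Prop :=
  ∀ A : Set M, Cardinal.mk A < κ → ∀ (n : ℕ) (a b : Fin n → M),
    SameType L A a b →
    (typeSet L (A ∪ Set.range b) a).Finite →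
    (typeSet L (A ∪ Set.range a) b).Finite →
    (typeSet L (A ∪ Set.range b) a).ncard = (typeSet L (A ∪ Set.range a) b).ncard

/-- `M` is `κ`-saturated: every finitely satisfiable set of formulas in finitely many free
variables with parameters from a set of size `< κ` is realized in `M`. -/
def Saturated (κ : Cardinal.{w}) : Prop :=
  ∀ A : Set M, Cardinal.mk A < κ →
    ∀ (n : ℕ) (T : Set (L.Formula (↥A ⊕ Fin n))),
      (∀ T₀ : Finset (L.Formula (↥A ⊕ Fin n)), ↑T₀ ⊆ T →
        ∃ v : Fin n → M, ∀ φ ∈ T₀, φ.Realize (Sum.elim (fun x => (x : M)) v)) →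
      ∃ v : Fin n → M, ∀ φ ∈ T, φ.Realize (Sum.elim (fun x => (x : M)) v)

/-- A function `f : X → Y` is relatively definable over `A` if its graph is the intersection
of an `A`-definable set with `X × Y`. -/
def RelativelyDefinableFn (A : Set M) {n m : ℕ} (X : Set (Fin n → M)) (Y : Set (Fin m → M))
    (f : (Fin n → M) → (Fin m → M)) : Prop :=
  ∃ D : Set ((Fin n ⊕ Fin m) → M), A.Definable L D ∧
    ∀ x ∈ X, ∀ y ∈ Y, (Sum.elim x y ∈ D ↔ f x = y)

/-- The `≡_A`-class of the pair `c`. -/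
def pairClass (A : Set M) {n m : ℕ} (c : (Fin n → M) × (Fin m → M)) :
    Set ((Fin n → M) × (Fin m → M)) :=
  {p | SameType L A (Sum.elim c.1 c.2) (Sum.elim p.1 p.2)}

/-- A complete correspondence over `A`: a correspondence which is a single `≡_A`-class. -/
def IsCompleteCorrespondence (A : Set M) {n m : ℕ} (X : Set (Fin n → M)) (Y : Set (Fin m → M))
    (C : Set ((Fin n → M) × (Fin m → M))) : Prop :=
  IsCorrespondence L A X Y C ∧ ∃ c ∈ C, C = pairClass L A c


section AuxiliaryLemmas

variable {L} {A : Set M}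

section SameType

variable {α β : Type*} {f g h : α → M}

theorem SameType.refl (f : α → M) : SameType L A f f := fun _ => Iff.rfl

theorem SameType.symm (hfg : SameType L A f g) : SameType L A g f := fun φ => (hfg φ).symm

theorem SameType.trans (hfg : SameType L A f g) (hgh : SameType L A g h) : SameType L A f h :=
  fun φ => (hfg φ).trans (hgh φ)

/-- Reindexing (for instance passing to a subtuple) preserves equality of types. -/
theorem SameType.comp (hfg : SameType L A f g) (e : β → α) : SameType L A (f ∘ e) (g ∘ e) := by
  intro φ
  have key := hfg (φ.relabel (Sum.map id e))
  simpa only [Language.Formula.realize_relabel, Sum.elim_comp_map, Function.comp_id] using key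

theorem sameType_automorphism (σ : M ≃[L] M) (hσ : ∀ x ∈ A, σ x = x) (f : α → M) :
    SameType L A f (σ ∘ f) := by
  intro φ
  have hval : Sum.elim (fun x : A => (x : M)) (σ ∘ f) = σ ∘ Sum.elim (fun x : A => (x : M)) f := by
    ext (x | i)
    · exact (hσ x x.2).symm
    · rfl
  rw [hval, Language.StrongHomClass.realize_formula]

/-- Strong homogeneity for tuples indexed by an arbitrary finite type. -/
theorem StronglyHomogeneousOver.exists_automorphism [Finite α]
    (hhom : StronglyHomogeneousOver L A) (hfg : SameType L A f g) :
    ∃ σ : M ≃[L] M, (∀ x ∈ A, σ x = x) ∧ σ ∘ f = g := by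
  obtain ⟨n, ⟨e⟩⟩ := Finite.exists_equiv_fin α
  obtain ⟨σ, hσ, hσf⟩ := hhom n _ _ (hfg.comp e.symm)
  refine ⟨σ, hσ, funext fun i => ?_⟩
  simpa using hσf (e i)

theorem TypeDefinable.mem_of_sameType {s : Set (α → M)} (hs : TypeDefinable L A s)
    (hfg : SameType L A f g) (hf : f ∈ s) : g ∈ s := by
  obtain ⟨S, hS, rfl⟩ := hs
  intro t ht
  obtain ⟨φ, rfl⟩ := definable_iff_exists_formula_sum.1 (hS t ht)
  exact (hfg φ).1 (hf _ ht)

theorem typeDefinable_typeSet (f : α → M) : TypeDefinable L A (typeSet L A f) := by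
  refine ⟨{t | A.Definable L t ∧ f ∈ t}, fun t ht => ht.1, Set.ext fun g => ⟨?_, ?_⟩⟩
  · rintro hg t ⟨ht, hft⟩
    obtain ⟨φ, rfl⟩ := definable_iff_exists_formula_sum.1 ht
    exact (hg φ).1 hft
  · intro hg φ
    constructor
    · intro hf
      exact hg _ ⟨definable_iff_exists_formula_sum.2 ⟨φ, rfl⟩, hf⟩
    · intro hφ
      by_contra hf
      exact hg _ ⟨definable_iff_exists_formula_sum.2 ⟨φ.not, rfl⟩, hf⟩ hφ

end SameType

section PairClass

variable {n m : ℕ} {C : Set ((Fin n → M) × (Fin m → M))} {c d : (Fin n → M) × (Fin m → M)}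

theorem mem_pairClass_self (c : (Fin n → M) × (Fin m → M)) : c ∈ pairClass L A c :=
  SameType.refl _

theorem pairClass_eq_of_mem (hd : d ∈ pairClass L A c) : pairClass L A d = pairClass L A c :=
  Set.ext fun _ => ⟨fun h => SameType.trans hd h, fun h => SameType.trans (SameType.symm hd) h⟩

theorem sameType_fst_of_mem_pairClass (hd : d ∈ pairClass L A c) : SameType L A c.1 d.1 :=
  SameType.comp hd Sum.inl

theorem sameType_snd_of_mem_pairClass (hd : d ∈ pairClass L A c) : SameType L A c.2 d.2 :=
  SameType.comp hd Sum.inr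

theorem typeDefinable_pairSet_pairClass (c : (Fin n → M) × (Fin m → M)) :
    TypeDefinable L A (pairSet (pairClass L A c)) := by
  have hset : pairSet (pairClass L A c) = typeSet L A (Sum.elim c.1 c.2) := by
    ext v
    simp [pairSet, pairClass, typeSet, Sum.elim_comp_inl_inr]
  rw [hset]
  exact typeDefinable_typeSet _

theorem pairClass_subset (hC : TypeDefinable L A (pairSet C)) (hc : c ∈ C) :
    pairClass L A c ⊆ C := by
  intro d hd
  exact hC.mem_of_sameType (f := Sum.elim c.1 c.2) (g := Sum.elim d.1 d.2) hd hc

theorem map_mem_of_typeDefinable (hC : TypeDefinable L A (pairSet C)) (σ : M ≃[L] M)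
    (hσ : ∀ x ∈ A, σ x = x) (hc : c ∈ C) : (σ ∘ c.1, σ ∘ c.2) ∈ C := by
  refine pairClass_subset hC hc ?_
  have h := sameType_automorphism σ hσ (Sum.elim c.1 c.2)
  rwa [Sum.comp_elim] at h

theorem map_mem_iff_of_typeDefinable (hC : TypeDefinable L A (pairSet C)) (σ : M ≃[L] M)
    (hσ : ∀ x ∈ A, σ x = x) : (σ ∘ c.1, σ ∘ c.2) ∈ C ↔ c ∈ C := by
  refine ⟨fun h => ?_, map_mem_of_typeDefinable hC σ hσ⟩
  have hsymm : ∀ x ∈ A, σ.symm x = x := fun x hx => by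
    conv_lhs => rw [← hσ x hx]
    exact σ.toEquiv.symm_apply_apply x
  have hcomp : ∀ {k : ℕ} (f : Fin k → M), σ.symm ∘ σ ∘ f = f := fun f =>
    funext fun i => σ.toEquiv.symm_apply_apply (f i)
  simpa only [hcomp] using map_mem_of_typeDefinable hC σ.symm hsymm h

/-- An automorphism fixing the parameters permutes the tuples. -/
theorem bijective_automorphism_comp (σ : M ≃[L] M) (k : ℕ) :
    Function.Bijective fun f : Fin k → M => σ ∘ f :=
  (Equiv.arrowCongr (Equiv.refl (Fin k)) σ.toEquiv).bijective

theorem ncard_fiber_eq (hhom : StronglyHomogeneousOver L A) (hC : TypeDefinable L A (pairSet C))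
    {x x' : Fin n → M} (hx : SameType L A x x') :
    {y | (x', y) ∈ C}.ncard = {y | (x, y) ∈ C}.ncard := by
  obtain ⟨σ, hσ, rfl⟩ := hhom.exists_automorphism hx
  have hb := bijective_automorphism_comp σ m
  rw [← Set.ncard_preimage_of_injective_subset_range hb.1 (by simp [hb.2.range_eq])]
  congr 1
  ext y
  exact map_mem_iff_of_typeDefinable (c := (x, y)) hC σ hσ

theorem ncard_cofiber_eq (hhom : StronglyHomogeneousOver L A)
    (hC : TypeDefinable L A (pairSet C)) {y y' : Fin m → M} (hy : SameType L A y y') :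
    {x | (x, y') ∈ C}.ncard = {x | (x, y) ∈ C}.ncard := by
  obtain ⟨σ, hσ, rfl⟩ := hhom.exists_automorphism hy
  have hb := bijective_automorphism_comp σ n
  rw [← Set.ncard_preimage_of_injective_subset_range hb.1 (by simp [hb.2.range_eq])]
  congr 1
  ext x
  exact map_mem_iff_of_typeDefinable (c := (x, y)) hC σ hσ

theorem exists_fst_mem_pairClass (hhom : StronglyHomogeneousOver L A) {x : Fin n → M}
    (hx : SameType L A c.1 x) : ∃ y, (x, y) ∈ pairClass L A c := by
  obtain ⟨σ, hσ, rfl⟩ := hhom.exists_automorphism hx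
  exact ⟨σ ∘ c.2, map_mem_of_typeDefinable (typeDefinable_pairSet_pairClass c) σ hσ
    (mem_pairClass_self c)⟩

theorem exists_snd_mem_pairClass (hhom : StronglyHomogeneousOver L A) {y : Fin m → M}
    (hy : SameType L A c.2 y) : ∃ x, (x, y) ∈ pairClass L A c := by
  obtain ⟨σ, hσ, rfl⟩ := hhom.exists_automorphism hy
  exact ⟨σ ∘ c.1, map_mem_of_typeDefinable (typeDefinable_pairSet_pairClass c) σ hσ
    (mem_pairClass_self c)⟩

variable {a : Fin n → M} {b : Fin m → M}

/-- The complete type of a point of a correspondence is a complete correspondence. -/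
theorem IsCorrespondence.isCompleteCorrespondence_pairClass {X : Set (Fin n → M)}
    {Y : Set (Fin m → M)} (hC : IsCorrespondence L A X Y C) (hc : c ∈ C) :
    IsCompleteCorrespondence L A X Y (pairClass L A c) := by
  have hsub := pairClass_subset hC.typeDefinable hc
  exact ⟨⟨⟨c, mem_pairClass_self c⟩, hsub.trans hC.subset, typeDefinable_pairSet_pairClass c,
    fun x hx => (hC.finite_fibers x hx).subset fun _ h => hsub h,
    fun y hy => (hC.finite_cofibers y hy).subset fun _ h => hsub h⟩,
    c, mem_pairClass_self c, rfl⟩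

/-- Under strong homogeneity every correspondence between complete types is uniform. -/
theorem IsCorrespondence.isUniformCorrespondence (hhom : StronglyHomogeneousOver L A)
    (hC : IsCorrespondence L A (typeSet L A a) (typeSet L A b) C) :
    IsUniformCorrespondence L A (typeSet L A a) (typeSet L A b) C
      {y | (a, y) ∈ C}.ncard {x | (x, b) ∈ C}.ncard := by
  obtain ⟨c, hc⟩ := hC.nonempty
  have hsub := pairClass_subset hC.typeDefinable hc
  refine ⟨hC, ?_, ?_, fun x hx => ncard_fiber_eq hhom hC.typeDefinable hx,
    fun y hy => ncard_cofiber_eq hhom hC.typeDefinable hy⟩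
  · obtain ⟨y, hy⟩ := exists_fst_mem_pairClass hhom (SameType.symm (hC.subset hc).1)
    exact (Set.ncard_pos (hC.finite_fibers a (SameType.refl a))).2 ⟨y, hsub hy⟩
  · obtain ⟨x, hx⟩ := exists_snd_mem_pairClass hhom (SameType.symm (hC.subset hc).2)
    exact (Set.ncard_pos (hC.finite_cofibers b (SameType.refl b))).2 ⟨x, hsub hx⟩

/-- The preimage of a type-definable set `C` of pairs is partitioned by the preimages of the
`≡_A`-classes of the pairs in `C`. -/
theorem ncard_eq_sum_ncard_pairClass {ι : Type*} (hC : TypeDefinable L A (pairSet C))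
    (i : ι → (Fin n → M) × (Fin m → M)) (hfin : (i ⁻¹' C).Finite)
    (T : Finset (Set ((Fin n → M) × (Fin m → M)))) (hT : (T : Set _) = pairClass L A '' C) :
    (i ⁻¹' C).ncard = ∑ D ∈ T, (i ⁻¹' D).ncard := by
  classical
  have hTmem : ∀ D, D ∈ T ↔ D ∈ pairClass L A '' C := fun D => by rw [← hT, Finset.mem_coe]
  rw [Set.ncard_eq_toFinset_card _ hfin, Finset.card_eq_sum_card_fiberwise
    (f := fun j => pairClass L A (i j)) (t := T)
    fun j hj => (hTmem _).2 ⟨i j, by simpa using hj, rfl⟩]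
  refine Finset.sum_congr rfl fun D hD => ?_
  obtain ⟨c, hc, rfl⟩ := (hTmem D).1 hD
  rw [← Set.ncard_coe_finset]
  congr 1
  ext j
  simp only [Finset.coe_filter, Finite.mem_toFinset, mem_preimage, mem_ofPred_eq]
  exact ⟨fun h => h.2 ▸ mem_pairClass_self _,
    fun h => ⟨pairClass_subset hC hc h, pairClass_eq_of_mem h⟩⟩

/-- If all complete correspondences between two complete types have ratio `r`, so do all
uniform ones. -/
theorem IsUniformCorrespondence.ratio_eq (hhom : StronglyHomogeneousOver L A) {r : ℚ}
    (hr : ∀ C k ℓ, IsCompleteCorrespondence L A (typeSet L A a) (typeSet L A b) C →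
      IsUniformCorrespondence L A (typeSet L A a) (typeSet L A b) C k ℓ → (k : ℚ) / (ℓ : ℚ) = r)
    {k ℓ : ℕ} (hC : IsUniformCorrespondence L A (typeSet L A a) (typeSet L A b) C k ℓ) :
    (k : ℚ) / (ℓ : ℚ) = r := by
  have hfa := hC.finite_fibers a (SameType.refl a)
  have hfb := hC.finite_cofibers b (SameType.refl b)
  have hTfin : (pairClass L A '' C).Finite := by
    refine (hfa.image fun y => pairClass L A (a, y)).subset ?_
    rintro _ ⟨c, hc, rfl⟩
    obtain ⟨y, hy⟩ := exists_fst_mem_pairClass hhom (SameType.symm (hC.subset hc).1)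
    exact ⟨y, pairClass_subset hC.typeDefinable hc hy, pairClass_eq_of_mem hy⟩
  have hT := hTfin.coe_toFinset
  have hk : k = ∑ D ∈ hTfin.toFinset, {y | (a, y) ∈ D}.ncard :=
    (hC.fiber_card a (SameType.refl a)).symm.trans
      (ncard_eq_sum_ncard_pairClass hC.typeDefinable (fun y => (a, y)) hfa _ hT)
  have hl : ℓ = ∑ D ∈ hTfin.toFinset, {x | (x, b) ∈ D}.ncard :=
    (hC.cofiber_card b (SameType.refl b)).symm.trans
      (ncard_eq_sum_ncard_pairClass hC.typeDefinable (fun x => (x, b)) hfb _ hT)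
  have hl0 : (ℓ : ℚ) ≠ 0 := Nat.cast_ne_zero.2 hC.l_pos.ne'
  rw [div_eq_iff hl0, hk, hl, Nat.cast_sum, Nat.cast_sum, Finset.mul_sum]
  refine Finset.sum_congr rfl fun D hD => ?_
  obtain ⟨c, hc, rfl⟩ := hTfin.mem_toFinset.1 hD
  have hcomplete := hC.toIsCorrespondence.isCompleteCorrespondence_pairClass hc
  have huniform := hcomplete.1.isUniformCorrespondence hhom
  exact (div_eq_iff (Nat.cast_ne_zero.2 huniform.l_pos.ne')).1 (hr _ _ _ hcomplete huniform)

end PairClass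

end AuxiliaryLemmas

/-- Complete types `p` and `q` are commensurable over `A` if and only if there
is a complete correspondence over `A` between them and all complete correspondences over `A`
between them have the same ratio; moreover this common ratio is `m_p^q`. -/
theorem statement8 (L : FirstOrder.Language.{u, v}) (M : Type w) [L.Structure M]
    (A : Set M) (hhom : StronglyHomogeneousOver L A) (n m : ℕ)
    (a : Fin n → M) (b : Fin m → M) :
    (CommensurableOver L A (typeSet L A a) (typeSet L A b) ↔
      ((∃ C, IsCompleteCorrespondence L A (typeSet L A a) (typeSet L A b) C) ∧
        ∃ r : ℚ, ∀ C k ℓ,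
          IsCompleteCorrespondence L A (typeSet L A a) (typeSet L A b) C →
          IsUniformCorrespondence L A (typeSet L A a) (typeSet L A b) C k ℓ →
          (k : ℚ) / (ℓ : ℚ) = r)) ∧
    (∀ r : ℚ, CommensurableOverWithRatio L A (typeSet L A a) (typeSet L A b) r →
      ∀ C k ℓ,
        IsCompleteCorrespondence L A (typeSet L A a) (typeSet L A b) C →
        IsUniformCorrespondence L A (typeSet L A a) (typeSet L A b) C k ℓ →
        (k : ℚ) / (ℓ : ℚ) = r) := by
  refine ⟨⟨?_, ?_⟩, fun r hr C k ℓ _ hu => hr.2 C k ℓ hu⟩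
  · rintro ⟨r, ⟨C, k, ℓ, hC⟩, hr⟩
    obtain ⟨c, hc⟩ := hC.nonempty
    exact ⟨⟨_, hC.toIsCorrespondence.isCompleteCorrespondence_pairClass hc⟩,
      r, fun C k ℓ _ hu => hr C k ℓ hu⟩
  · rintro ⟨⟨C, hC⟩, r, hr⟩
    exact ⟨r, ⟨C, _, _, hC.1.isUniformCorrespondence hhom⟩,
      fun D k ℓ hD => hD.ratio_eq hhom hr⟩

end Unimod
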